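/- arXiv:1610.04846 — 5 statements merged into one kernel-verified Lean document; each statement's English description precedes it below -/
import Mathlib

section
/- Let J be a finite-dimensional nilpotent associative algebra over the finite field 𝔽_q, let ε : (𝔽_q,+) → ℂˣ be a group homomorphism, and let λ ∈ J*. Then J_{λ,rt} = {x ∈ J : λ(xy) = 0 for all y ∈ J} is a subgroup of the group (J,∘) with x∘y = x + y + xy, and the map ξ_λ : x ↦ ε(λ(x)) is a group homomorphism from (J_{λ,rt},∘) to ℂˣ. -/
/-- Left-bracketed product of a nonempty list of elements of a (not necessarily unital)
algebra. -/
def listMul {A : Type*} [Mul A] : A → List A → A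
  | x, [] => x
  | x, y :: l => listMul (x * y) l

/-- An associative (not necessarily unital) algebra is nilpotent if every product of `n`
elements vanishes, for some `n ≥ 1`. -/
def IsNilpotentAlgebra (A : Type*) [Mul A] [Zero A] : Prop :=
  ∃ n : ℕ, 0 < n ∧ ∀ (x : A) (l : List A), l.length + 1 = n → listMul x l = 0

/-- The quasi-multiplication `x ∘ y = x + y + xy` on a (not necessarily unital) algebra. -/
def qmul {J : Type*} [Add J] [Mul J] (x y : J) : J := x + y + x * y

/-- The right stabilizer `J_{λ,rt} = {x ∈ J : λ(xy) = 0 for all y ∈ J}`. -/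
def rtSet {F J : Type*} [Field F] [NonUnitalRing J] [Module F J]
    (lam : Module.Dual F J) : Set J :=
  {x : J | ∀ y : J, lam (x * y) = 0}

/-- For a finite-dimensional nilpotent associative algebra `J` over a
finite field `F = 𝔽_q`, a homomorphism `ε : (F,+) → ℂˣ`, and `λ ∈ J*`, the right
stabilizer `J_{λ,rt}` is a subgroup of the algebra group `(J,∘)` (it contains the
identity `0`, is closed under `∘`, and is closed under quasi-inverses), and
`ξ_λ : x ↦ ε(λ(x))` is a group homomorphism from `(J_{λ,rt},∘)` to `ℂˣ`. -/
theorem rightStab_subgroup_and_linear_character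
    {F J : Type*} [Field F] [Fintype F] [NonUnitalRing J] [Module F J]
    [IsScalarTower F J J] [SMulCommClass F J J] [FiniteDimensional F J]
    (hnil : IsNilpotentAlgebra J)
    (ε : F → ℂˣ) (hε : ∀ a b : F, ε (a + b) = ε a * ε b)
    (lam : Module.Dual F J) :
    ((0 : J) ∈ rtSet lam) ∧
    (∀ x y : J, x ∈ rtSet lam → y ∈ rtSet lam → qmul x y ∈ rtSet lam) ∧
    (∀ x y : J, x ∈ rtSet lam → qmul x y = 0 → qmul y x = 0 → y ∈ rtSet lam) ∧
    (∀ x y : J, x ∈ rtSet lam → y ∈ rtSet lam →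
      ε (lam (qmul x y)) = ε (lam x) * ε (lam y)) := by
  refine ⟨fun z => by simp, fun x y hx hy z => ?_, fun x y hx h _ z => ?_, fun x y hx hy => ?_⟩
  · have h1 := hx z
    have h2 := hy z
    have h3 := hx (y * z)
    simp only [qmul, add_mul, map_add, mul_assoc, h1, h2, h3, add_zero]
  · have h1 := hx z
    have h3 := hx (y * z)
    have h4 : lam (qmul x y * z) = 0 := by rw [h, zero_mul, map_zero]
    simpa only [qmul, add_mul, map_add, mul_assoc, h1, h3, add_zero, zero_add] using h4
  · have h1 := hx y
    rw [← hε]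
    simp only [qmul, map_add, h1, add_zero]
end

section
/- Let T be a finite group acting on a finite set X, let S ⊆ X be a nonempty subset, let φ : X → ℂ vanish outside S, and let ψ : X → ℂ be constant on T-orbits (ψ(τ·x) = ψ(x) for all τ ∈ T, x ∈ X). Define the superinduced function SInd φ : X → ℂ by SInd φ(x) = (|X| / (|T|·|S|)) · Σ_{τ∈T} φ(τ·x). Then (1/|X|) Σ_{x∈X} SInd φ(x) · conj(ψ(x)) = (1/|S|) Σ_{s∈S} φ(s) · conj(ψ(s)). (This is the Frobenius reciprocity formula for superinduction: applied with X the finite group of triangular type G = H + J, T = G̃ the group of triples (t,a,b) acting by ρ_τ(g) = 1 + ta(g−1)b⁻¹t⁻¹, and S the subgroup G', it gives (SInd φ, ψ) = (φ, Res ψ).) -/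
/-- Frobenius reciprocity for superinduction.  Let a finite group `T` act
on a finite set `X`, let `S ⊆ X` be nonempty, let `φ : X → ℂ` vanish outside `S`, and let
`ψ : X → ℂ` be constant on `T`-orbits.  With
`SInd φ (x) = (|X|/(|T|·|S|)) Σ_{τ∈T} φ(τ·x)`, we get
`(SInd φ, ψ) = (1/|S|) Σ_{s∈S} φ(s) conj(ψ(s))`. -/
theorem superinduction_frobenius_reciprocity
    {T X : Type*} [Group T] [Fintype T] [Fintype X] [MulAction T X]
    (S : Finset X) (hS : S.Nonempty)
    (φ ψ : X → ℂ)
    (hφ : ∀ x : X, x ∉ S → φ x = 0)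
    (hψ : ∀ (τ : T) (x : X), ψ (τ • x) = ψ x) :
    (1 / (Fintype.card X : ℂ)) *
        ∑ x : X, (((Fintype.card X : ℂ) / ((Fintype.card T : ℂ) * (S.card : ℂ))) *
          ∑ τ : T, φ (τ • x)) * star (ψ x)
      = (1 / (S.card : ℂ)) * ∑ s ∈ S, φ s * star (ψ s) := by
  have key : ∑ x : X, (∑ τ : T, φ (τ • x)) * star (ψ x)
      = (Fintype.card T : ℂ) * ∑ s ∈ S, φ s * star (ψ s) := by
    have h1 : ∑ s ∈ S, φ s * star (ψ s) = ∑ x : X, φ x * star (ψ x) := by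
      apply Finset.sum_subset (Finset.subset_univ S)
      intro x _ hx
      rw [hφ x hx, zero_mul]
    have h2 : ∀ τ : T, ∑ x : X, φ (τ • x) * star (ψ x) = ∑ x : X, φ x * star (ψ x) := by
      intro τ
      rw [← Equiv.sum_comp (MulAction.toPerm τ) (fun x => φ x * star (ψ x))]
      apply Finset.sum_congr rfl
      intro x _
      simp only [MulAction.toPerm_apply, hψ]
    simp_rw [Finset.sum_mul]
    rw [Finset.sum_comm, Finset.sum_congr rfl (fun τ _ => h2 τ), h1]
    simp
  have hX : (Fintype.card X : ℂ) ≠ 0 := by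
    obtain ⟨x, _⟩ := hS
    haveI : Nonempty X := ⟨x⟩
    exact_mod_cast Fintype.card_ne_zero
  have hT : (Fintype.card T : ℂ) ≠ 0 := by
    exact_mod_cast Fintype.card_ne_zero
  have hC : (S.card : ℂ) ≠ 0 := by
    exact_mod_cast hS.card_pos.ne'
  simp_rw [mul_assoc]
  rw [← Finset.mul_sum, key]
  field_simp
end

section
/- Let J be a finite-dimensional nilpotent associative algebra over the finite field 𝔽_q and let J' ⊆ J be a subalgebra. Call ψ : J → ℂ a superclass function if ψ(x + ux + xv + uxv) = ψ(x) for all x,u,v ∈ J, and call φ : J' → ℂ a superclass function on J' if φ(x + ux + xv + uxv) = φ(x) for all x,u,v ∈ J'. Extend φ by zero to φ̇ : J → ℂ. Define SInd φ : J → ℂ by SInd φ(x) = (1/(|J|·|J'|)) Σ_{u∈J} Σ_{v∈J} φ̇(x + ux + xv + uxv). Then for every superclass function ψ on J and superclass function φ on J', (1/|J|) Σ_{x∈J} SInd φ(x)·conj(ψ(x)) = (1/|J'|) Σ_{x∈J'} φ(x)·conj(ψ(x)). -/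
theorem aux_right {A : Type*} [NonUnitalRing A] (v : A) (k : ℕ) :
    ∀ y : A, y * v = -y → listMul y (List.replicate k v) = y ∨
      listMul y (List.replicate k v) = -y := by
  induction k with
  | zero => intro y _; left; rfl
  | succ k ih =>
    intro y hy
    have h := ih (-y) (by rw [neg_mul, hy])
    rw [List.replicate_succ, listMul, hy]
    rw [neg_neg] at h
    exact h.symm

theorem aux_left {A : Type*} [NonUnitalRing A] (u x : A) (hx : u * x = -x) (k : ℕ) :
    ∀ a : A, (a * x = x ∨ a * x = -x) → (listMul a (List.replicate k u) * x = x ∨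
      listMul a (List.replicate k u) * x = -x) := by
  induction k with
  | zero => intro a h; exact h
  | succ k ih =>
    intro a h
    rw [List.replicate_succ, listMul]
    apply ih
    rw [mul_assoc, hx, mul_neg]
    rcases h with h | h
    · right; rw [h]
    · left; rw [h, neg_neg]

theorem aux_inj {A : Type*} [NonUnitalRing A] (hnil : IsNilpotentAlgebra A) (u v : A) :
    Function.Injective (fun x : A => x + u * x + x * v + u * x * v) := by
  obtain ⟨n, hn, h⟩ := hnil
  intro a b hab
  have hab : a + u * a + a * v + u * a * v = b + u * b + b * v + u * b * v := hab
  have h1 : ∀ y : A, y * v = -y → y = 0 := by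
    intro y hy
    have h0 := h y (List.replicate (n-1) v) (by simp; omega)
    rcases aux_right v (n-1) y hy with h' | h'
    · rw [← h', h0]
    · rw [h0] at h'; exact neg_eq_zero.mp h'.symm
  have h2 : ∀ x : A, u * x = -x → x = 0 := by
    intro x hx
    have h0 := h u (List.replicate (n-1) u) (by simp; omega)
    rcases aux_left u x hx (n-1) u (Or.inr hx) with h' | h'
    · rw [← h', h0, zero_mul]
    · rw [h0, zero_mul] at h'; exact neg_eq_zero.mp h'.symm
  have h3 : (a - b) + u * (a - b) = 0 := by
    apply h1
    rw [eq_neg_iff_add_eq_zero, ← sub_eq_zero.mpr hab]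
    noncomm_ring
  have h4 := h2 (a - b) (by rw [eq_neg_iff_add_eq_zero, add_comm]; exact h3)
  exact sub_eq_zero.mp h4

/-- Frobenius reciprocity for superinduction in algebra groups.  Let `J`
be a finite-dimensional nilpotent associative algebra over `𝔽_q` and `J' ⊆ J` a
subalgebra.  For a superclass function `φ` on `J'` (extended by zero to `J`) and a
superclass function `ψ` on `J`, with
`SInd φ (x) = (1/(|J|·|J'|)) Σ_{u,v ∈ J} φ̇(x + ux + xv + uxv)`, we have
`(SInd φ, ψ) = (φ, Res ψ)`. -/
theorem algebra_group_superinduction_reciprocity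
    {F J : Type*} [Field F] [Fintype F] [NonUnitalRing J] [Module F J]
    [IsScalarTower F J J] [SMulCommClass F J J] [Fintype J]
    (hnil : IsNilpotentAlgebra J)
    (J' : Submodule F J) (hmul : ∀ x ∈ J', ∀ y ∈ J', x * y ∈ J')
    (S : Finset J) (hSmem : ∀ x : J, x ∈ S ↔ x ∈ J')
    (φ ψ : J → ℂ)
    (hφ0 : ∀ x : J, x ∉ J' → φ x = 0)
    (hφ : ∀ x ∈ J', ∀ u ∈ J', ∀ v ∈ J',
      φ (x + u * x + x * v + u * x * v) = φ x)
    (hψ : ∀ x u v : J, ψ (x + u * x + x * v + u * x * v) = ψ x) :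
    (1 / (Fintype.card J : ℂ)) *
        ∑ x : J, ((1 / ((Fintype.card J : ℂ) * (S.card : ℂ))) *
          ∑ u : J, ∑ v : J, φ (x + u * x + x * v + u * x * v)) * star (ψ x)
      = (1 / (S.card : ℂ)) * ∑ x ∈ S, φ x * star (ψ x) := by
  have key : ∀ u v : J, ∑ x : J, φ (x + u * x + x * v + u * x * v) * star (ψ x)
      = ∑ x ∈ S, φ x * star (ψ x) := by
    intro u v
    have hb := Finite.injective_iff_bijective.mp (aux_inj hnil u v)
    have e : ∑ x ∈ S, φ x * star (ψ x) = ∑ x : J, φ x * star (ψ x) := by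
      apply Finset.sum_subset (Finset.subset_univ S)
      intro x _ hx
      rw [hφ0 x (fun h => hx ((hSmem x).mpr h)), zero_mul]
    rw [e, ← hb.sum_comp (fun x => φ x * star (ψ x))]
    exact Finset.sum_congr rfl (fun x _ => by rw [hψ])
  have hJ : (Fintype.card J : ℂ) ≠ 0 := by
    exact_mod_cast Fintype.card_ne_zero
  have hsum : ∑ x : J, (∑ u : J, ∑ v : J, φ (x + u * x + x * v + u * x * v)) * star (ψ x)
      = (Fintype.card J : ℂ) * ((Fintype.card J : ℂ) * ∑ x ∈ S, φ x * star (ψ x)) := by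
    simp_rw [Finset.sum_mul]
    rw [Finset.sum_comm]
    have : ∀ u : J, ∑ x : J, ∑ v : J, φ (x + u * x + x * v + u * x * v) * star (ψ x)
        = (Fintype.card J : ℂ) * ∑ x ∈ S, φ x * star (ψ x) := by
      intro u
      rw [Finset.sum_comm, Finset.sum_congr rfl (fun v _ => key u v)]
      simp
    rw [Finset.sum_congr rfl (fun u _ => this u)]
    simp
  simp_rw [mul_assoc (1 / ((Fintype.card J : ℂ) * (S.card : ℂ)))]
  rw [← Finset.mul_sum, hsum]
  have hS : (S.card : ℂ) ≠ 0 := by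
    have : S.card ≠ 0 := Finset.card_ne_zero_of_mem ((hSmem 0).mpr J'.zero_mem)
    exact_mod_cast this
  field_simp
end

section
/- Let J be a finite-dimensional nilpotent associative algebra over 𝔽_q, ε : (𝔽_q,+) → ℂˣ a nontrivial group homomorphism, and (J,∘) the group with x∘y = x + y + xy. For λ ∈ J*, define the supercharacter χ_λ : J → ℂ as the character induced from the linear character ξ_λ(x) = ε(λ(x)) of the subgroup J_{λ,rt} = {x : λ(xJ)=0}, i.e., χ_λ(g) = (1/|J_{λ,rt}|) Σ_{x∈J, x⁻¹∘g∘x ∈ J_{λ,rt}} ε(λ(x⁻¹∘g∘x)), where x⁻¹ is the inverse of x in (J,∘). Then for every subalgebra J' ⊆ J and every λ ∈ J*, there exist nonnegative integers n_μ, indexed by μ ∈ (J')*, such that the restriction of χ_λ to J' equals Σ_{μ∈(J')*} n_μ · χ'_μ, where χ'_μ is the supercharacter of (J',∘) defined by the same formula with J replaced by J'. -/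
/-- The supercharacter `χ_λ` of the algebra group `(J, ∘)` attached to `λ ∈ J*`: the
character induced from the linear character `ξ_λ(x) = ε(λ(x))` of the right stabilizer
`J_{λ,rt} = {x : λ(xJ) = 0}`, i.e.
`χ_λ(g) = (1/|J_{λ,rt}|) Σ_{x ∈ J, x⁻¹∘g∘x ∈ J_{λ,rt}} ε(λ(x⁻¹∘g∘x))`,
where `inv x` denotes the inverse of `x` in `(J, ∘)`. -/
noncomputable def superchar {F J : Type*} [Field F] [DecidableEq F] [Fintype J]
    [NonUnitalRing J] [Module F J]
    (ε : F → ℂ) (inv : J → J) (lam : Module.Dual F J) (g : J) : ℂ :=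
  (1 / ((Finset.univ.filter (fun x : J => ∀ y : J, lam (x * y) = 0)).card : ℂ)) *
    ∑ x : J,
      if ∀ y : J, lam (qmul (qmul (inv x) g) x * y) = 0
        then ε (lam (qmul (qmul (inv x) g) x)) else 0

section Aux
open scoped Classical

theorem aux_part_mem {X Y : Type*} (s : Setoid Y) (K : Finset Y)
    (C : AddSubmonoid (X → ℂ)) (h : Y → X → ℂ)
    (hcl : ∀ y ∈ K, (∑ y' ∈ K with s y y', h y') ∈ C) : (∑ y ∈ K, h y) ∈ C := by
  rw [← Finset.sum_fiberwise_of_maps_to (s := K) (t := K.image (Quotient.mk s))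
    (g := Quotient.mk s) (fun i hi => Finset.mem_image_of_mem _ hi)]
  refine AddSubmonoid.sum_mem _ ?_
  intro q hq
  obtain ⟨y, hy, rfl⟩ := Finset.mem_image.1 hq
  convert hcl y hy using 2
  ext y'
  simp only [Finset.mem_filter, and_congr_right_iff]
  intro _
  rw [Quotient.eq]
  exact ⟨fun h => s.symm h, fun h => s.symm h⟩

theorem aux_count {X Y : Type*} [AddCommGroup X] [Fintype X] (f : X → Y) (R : Finset X)
    (hf : ∀ x x', f x = f x' ↔ x - x' ∈ R) (φ : Y → ℂ) :
    ∑ x, φ (f x) = (R.card : ℂ) * ∑ y ∈ Finset.univ.image f, φ y := by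
  rw [Finset.sum_comp, Finset.mul_sum]
  refine Finset.sum_congr rfl ?_
  intro y hy
  obtain ⟨x0, -, rfl⟩ := Finset.mem_image.1 hy
  rw [nsmul_eq_mul]
  congr 2
  refine Finset.card_bij' (fun x _ => x - x0) (fun x _ => x + x0) ?_ ?_ ?_ ?_
  · intro x hx
    exact (hf _ _).1 (Finset.mem_filter.1 hx).2
  · intro x hx
    refine Finset.mem_filter.2 ⟨Finset.mem_univ _, (hf _ _).2 ?_⟩
    simpa using hx
  · intro x _; simp
  · intro x _; simp

variable {F : Type*} [Field F]

instance aux_dual_finite {K : Type*} [AddCommGroup K] [Module F K] [Finite F] [Finite K] :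
    Finite (Module.Dual F K) := DFunLike.finite _

noncomputable instance aux_dual_fintype {K : Type*} [AddCommGroup K] [Module F K]
    [Finite F] [Finite K] : Fintype (Module.Dual F K) := Fintype.ofFinite _

/-- Fourier inversion on a subspace. -/
theorem aux_fourier [Finite F] {K : Type*} [AddCommGroup K] [Module F K] [Fintype K]
    (ε : F → ℂ) (hε : ∀ a b : F, ε (a + b) = ε a * ε b) (hεnt : ∃ a : F, ε a ≠ 1)
    (R : Submodule F K) (μ : Module.Dual F K) (g : K) :
    (Nat.card R : ℂ) * ∑ κ : Module.Dual F K with (∀ x ∈ R, κ x = μ x), ε (κ g)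
      = (Fintype.card K : ℂ) * if g ∈ R then ε (μ g) else 0 := by
  split_ifs with hg
  · rw [Finset.sum_congr rfl (g := fun _ => ε (μ g))
      (fun κ hκ => by rw [(Finset.mem_filter.1 hκ).2 g hg])]
    rw [Finset.sum_const, nsmul_eq_mul, ← mul_assoc]
    congr 1
    have h1 : (Finset.univ.filter (fun κ : Module.Dual F K => ∀ x ∈ R, κ x = μ x)).card
        = Nat.card R.dualAnnihilator := by
      rw [← Fintype.card_subtype, ← Nat.card_eq_fintype_card]
      refine Nat.card_congr
        { toFun := fun κ => ⟨κ.1 - μ, ?_⟩, invFun := fun κ => ⟨κ.1 + μ, ?_⟩,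
          left_inv := ?_, right_inv := ?_ }
      · rw [Submodule.mem_dualAnnihilator]
        intro x hx
        simp [κ.2 x hx]
      · intro x hx
        have := (Submodule.mem_dualAnnihilator _).1 κ.2 x hx
        simp [this]
      · intro κ; simp
      · intro κ; simp
    have h2 : Nat.card (K ⧸ R) = Nat.card R.dualAnnihilator :=
      Nat.card_congr (Subspace.quotEquivAnnihilator R).toEquiv
    rw [h1, ← h2, ← Nat.card_eq_fintype_card, Submodule.card_eq_card_quotient_mul_card R]
    push_cast; ring
  · obtain ⟨a, ha⟩ := hεnt
    obtain ⟨f, hf, hfR⟩ := Submodule.exists_dual_map_eq_bot_of_notMem hg inferInstance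
    have hf0 : ∀ x ∈ R, f x = 0 := by
      intro x hx
      have : f x ∈ R.map f := Submodule.mem_map_of_mem hx
      rw [hfR] at this
      exact (Submodule.mem_bot F).1 this
    let ρ : Module.Dual F K := (a / f g) • f
    have hρ : ρ g = a := by simp [ρ, hf]
    have hρ0 : ∀ x ∈ R, ρ x = 0 := by intro x hx; simp [ρ, hf0 x hx]
    set S := ∑ κ : Module.Dual F K with (∀ x ∈ R, κ x = μ x), ε (κ g) with hS
    have : S = ε a * S := by
      conv_lhs => rw [hS]
      rw [hS, Finset.mul_sum]
      refine Finset.sum_bij' (fun κ _ => κ - ρ) (fun κ _ => κ + ρ) ?_ ?_ ?_ ?_ ?_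
      · intro κ hκ
        refine Finset.mem_filter.2 ⟨Finset.mem_univ _, fun x hx => ?_⟩
        simp [hρ0 x hx, (Finset.mem_filter.1 hκ).2 x hx]
      · intro κ hκ
        refine Finset.mem_filter.2 ⟨Finset.mem_univ _, fun x hx => ?_⟩
        simp [hρ0 x hx, (Finset.mem_filter.1 hκ).2 x hx]
      · intro κ _; simp
      · intro κ _; simp
      · intro κ _
        rw [← hε]; simp [hρ]
    have h0 : (1 - ε a) * S = 0 := by rw [sub_mul, one_mul, ← this, sub_self]
    rcases mul_eq_zero.1 h0 with h | h
    · exact absurd (sub_eq_zero.1 h).symm ha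
    · rw [h]; simp

/-- The right stabilizer as a subspace. -/
def auxS {K : Type*} [NonUnitalRing K] [Module F K] [IsScalarTower F K K]
    (μ : Module.Dual F K) : Submodule F K where
  carrier := {x | ∀ y, μ (x * y) = 0}
  add_mem' := by
    intro a b ha hb y
    rw [add_mul, map_add, ha, hb, add_zero]
  zero_mem' := by intro y; simp
  smul_mem' := by
    intro c x hx y
    rw [smul_mul_assoc, map_smul, hx, smul_zero]

theorem aux_mem_S {K : Type*} [NonUnitalRing K] [Module F K] [IsScalarTower F K K]
    (μ : Module.Dual F K) (x : K) : x ∈ auxS μ ↔ ∀ y, μ (x * y) = 0 := Iff.rfl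

theorem aux_inv_inv {K : Type*} [NonUnitalRing K] (inv : K → K)
    (hinv : ∀ x : K, qmul x (inv x) = 0 ∧ qmul (inv x) x = 0) (x : K) :
    inv (inv x) = x := by
  have h1 := (hinv x).1
  have h2 := (hinv (inv x)).1
  unfold qmul at h1 h2
  set a := inv x
  set b := inv a
  have e1 : a = -x - x * a := by
    rw [eq_sub_iff_add_eq, eq_neg_iff_add_eq_zero]; rw [← h1]; abel
  have h3 : x + (a + b + a * b) + x * (a + b + a * b) = x := by rw [h2]; simp
  have h4 : (x + a + x * a) + b + (x + a + x * a) * b = b := by rw [h1]; simp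
  have h5 : x + (a + b + a * b) + x * (a + b + a * b)
      = (x + a + x * a) + b + (x + a + x * a) * b := by noncomm_ring
  rw [h3, h4] at h5
  exact h5.symm

theorem aux_superchar_eq {K : Type*} [DecidableEq F] [NonUnitalRing K] [Module F K]
    [IsScalarTower F K K] [Fintype K]
    (ε : F → ℂ) (inv : K → K) (hinv : ∀ x : K, qmul x (inv x) = 0 ∧ qmul (inv x) x = 0)
    (μ : Module.Dual F K) (g : K) :
    superchar ε inv μ g = (1 / (Nat.card (auxS μ) : ℂ)) *
      ∑ x : K, if g + x * g ∈ auxS μ then ε (μ (g + x * g)) else 0 := by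
  unfold superchar
  congr 1
  · congr 2
    rw [Nat.card_eq_fintype_card, Fintype.card_subtype]
    congr 1
    ext x
    simp [aux_mem_S]
  · refine Finset.sum_bij' (fun x _ => inv x) (fun x _ => inv x) (by simp) (by simp)
      (fun x _ => aux_inv_inv inv hinv x) (fun x _ => aux_inv_inv inv hinv x) ?_
    intro x _
    have h1 := (hinv x).1
    have h2 := (hinv x).2
    unfold qmul at h1 h2
    set a := inv x
    have e : qmul (qmul a g) x = (g + a * g) + (g + a * g) * x := by
      have : qmul (qmul a g) x = (a + x + a * x) + ((g + a * g) + (g + a * g) * x) := by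
        unfold qmul; noncomm_ring
      rw [this, h2, zero_add]
    rw [e]
    have hiff : (∀ y, μ (((g + a * g) + (g + a * g) * x) * y) = 0) ↔ g + a * g ∈ auxS μ := by
      rw [aux_mem_S]
      constructor
      · intro h y
        have := h (y + a * y)
        have e2 : ((g + a * g) + (g + a * g) * x) * (y + a * y)
          = (g + a * g) * y + (g + a * g) * ((x + a + x * a) * y) := by noncomm_ring
        rw [e2, h1] at this
        simpa using this
      · intro h y
        have e2 : ((g + a * g) + (g + a * g) * x) * y = (g + a * g) * (y + x * y) := by
          noncomm_ring
        rw [e2, h]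
    by_cases hc : g + a * g ∈ auxS μ
    · rw [if_pos (hiff.2 hc), if_pos hc, map_add, (aux_mem_S _ _).1 hc x, add_zero]
    · rw [if_neg (fun h => hc (hiff.1 h)), if_neg hc]

/-- Averaged exponential. -/
noncomputable def auxf {K : Type*} [NonUnitalRing K] [Module F K] [Fintype K]
    (ε : F → ℂ) (κ : Module.Dual F K) (g : K) : ℂ :=
  (1 / (Fintype.card K : ℂ)) * ∑ x : K, ε (κ (g + x * g))

theorem aux_I_eq [Finite F] {K : Type*} [NonUnitalRing K] [Module F K] [Fintype K]
    (ε : F → ℂ) (hε : ∀ a b : F, ε (a + b) = ε a * ε b) (hεnt : ∃ a : F, ε a ≠ 1)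
    (R : Submodule F K) (μ : Module.Dual F K) (g : K) :
    (1 / (Nat.card R : ℂ)) * ∑ x : K, (if g + x * g ∈ R then ε (μ (g + x * g)) else 0)
      = ∑ κ : Module.Dual F K with (∀ x ∈ R, κ x = μ x), auxf ε κ g := by
  unfold auxf
  rw [← Finset.mul_sum, Finset.sum_comm, Finset.mul_sum, Finset.mul_sum]
  refine Finset.sum_congr rfl fun x _ => ?_
  have h := aux_fourier ε hε hεnt R μ (g + x * g)
  have hR : (Nat.card R : ℂ) ≠ 0 := Nat.cast_ne_zero.2 Nat.card_pos.ne'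
  have hK : (Fintype.card K : ℂ) ≠ 0 := Nat.cast_ne_zero.2 Fintype.card_ne_zero
  rw [one_div, one_div, inv_mul_eq_iff_eq_mul₀ hR, mul_left_comm, h, inv_mul_cancel_left₀ hK]

/-- Orbit relation for right multiplication. -/
def auxSetoid {K : Type*} [NonUnitalRing K] [Module F K]
    (inv : K → K) (hinv : ∀ x : K, qmul x (inv x) = 0 ∧ qmul (inv x) x = 0) :
    Setoid (Module.Dual F K) where
  r μ κ := ∃ y, ∀ x, κ x = μ (x + x * y)
  iseqv := by
    refine ⟨fun μ => ⟨0, by simp⟩, ?_, ?_⟩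
    · rintro μ κ ⟨y, hy⟩
      refine ⟨inv y, fun x => ?_⟩
      rw [hy]
      have h := (hinv y).2
      unfold qmul at h
      have : x + x * inv y + (x + x * inv y) * y = x + x * (inv y + y + inv y * y) := by
        noncomm_ring
      rw [this, h]; simp
    · rintro μ κ ρ ⟨y, hy⟩ ⟨z, hz⟩
      refine ⟨qmul z y, fun x => ?_⟩
      rw [hz, hy]
      congr 1
      unfold qmul; noncomm_ring

theorem aux_rel_iff {K : Type*} [Finite F] [NonUnitalRing K] [Module F K]
    [IsScalarTower F K K] [SMulCommClass F K K] [Fintype K]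
    (inv : K → K) (hinv : ∀ x : K, qmul x (inv x) = 0 ∧ qmul (inv x) x = 0)
    (μ κ : Module.Dual F K) :
    auxSetoid inv hinv μ κ ↔ ∀ x ∈ auxS μ, κ x = μ x := by
  constructor
  · rintro ⟨y, hy⟩ x hx
    rw [hy, map_add, hx y, add_zero]
  · intro h
    let T : K →ₗ[F] Module.Dual F K :=
      { toFun := fun y => μ ∘ₗ LinearMap.mulRight F y
        map_add' := by intro a b; ext x; simp [mul_add]
        map_smul' := by intro c b; ext x; simp [mul_smul_comm] }
    have hT : ∀ y x, T y x = μ (x * y) := fun y x => rfl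
    let W : Subspace F (Module.Dual F K) := LinearMap.range T
    have hmem : κ - μ ∈ W := by
      rw [← Subspace.dualCoannihilator_dualAnnihilator_eq (W := W),
        Submodule.mem_dualAnnihilator]
      intro x hx
      rw [LinearMap.sub_apply, sub_eq_zero]
      refine h x ?_
      intro y
      exact (Submodule.mem_dualCoannihilator _).1 hx (T y) ⟨y, rfl⟩
    obtain ⟨y, hy⟩ := hmem
    refine ⟨y, fun x => ?_⟩
    rw [map_add, ← hT, hy]; simp

theorem aux_cone {K : Type*} [Finite F] [DecidableEq F] [NonUnitalRing K] [Module F K]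
    [IsScalarTower F K K] [SMulCommClass F K K] [Fintype K]
    (ε : F → ℂ) (hε : ∀ a b : F, ε (a + b) = ε a * ε b) (hεnt : ∃ a : F, ε a ≠ 1)
    (inv : K → K) (hinv : ∀ x : K, qmul x (inv x) = 0 ∧ qmul (inv x) x = 0)
    (R : Submodule F K) (μ : Module.Dual F K) (hR : ∀ x ∈ R, ∀ y, x * y ∈ R)
    (hμ : ∀ x ∈ R, ∀ y, μ (x * y) = 0) :
    (∑ κ : Module.Dual F K with (∀ x ∈ R, κ x = μ x), auxf ε κ) ∈
      AddSubmonoid.closure (Set.range fun κ : Module.Dual F K => superchar ε inv κ) := by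
  refine aux_part_mem (auxSetoid inv hinv) _ _ _ ?_
  intro κ hκ
  have hκ := (Finset.mem_filter.1 hκ).2
  refine AddSubmonoid.subset_closure ⟨κ, ?_⟩
  funext g
  simp only
  rw [aux_superchar_eq ε inv hinv, aux_I_eq ε hε hεnt, Finset.sum_apply]
  refine Finset.sum_congr ?_ fun _ _ => rfl
  ext ρ
  simp only [Finset.mem_filter, Finset.mem_univ, true_and]
  rw [aux_rel_iff]
  refine ⟨fun h => ⟨fun x hx => ?_, h⟩, fun h => h.2⟩
  rw [h x, hκ x hx]
  intro y
  rw [hκ _ (hR x hx y), hμ x hx y]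

/-- The functional `z ↦ ν ((1+x) z)`. -/
def auxact {J : Type*} [NonUnitalRing J] [Module F J] [SMulCommClass F J J]
    (x : J) (ν : Module.Dual F J) : Module.Dual F J :=
  ν ∘ₗ (LinearMap.id + LinearMap.mulLeft F x)

theorem auxact_apply {J : Type*} [NonUnitalRing J] [Module F J] [SMulCommClass F J J]
    (x : J) (ν : Module.Dual F J) (z : J) : auxact x ν z = ν (z + x * z) := rfl

theorem auxact_act {J : Type*} [NonUnitalRing J] [Module F J] [SMulCommClass F J J]
    (x y : J) (ν : Module.Dual F J) : auxact x (auxact y ν) = auxact (qmul y x) ν := by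
  ext z
  simp only [auxact_apply]
  congr 1
  unfold qmul; noncomm_ring

theorem auxact_zero {J : Type*} [NonUnitalRing J] [Module F J] [SMulCommClass F J J]
    (ν : Module.Dual F J) : auxact 0 ν = ν := by
  ext z; simp [auxact_apply]

theorem auxact_eq_iff {J : Type*} [NonUnitalRing J] [Module F J] [IsScalarTower F J J]
    [SMulCommClass F J J]
    (x y : J) (ν : Module.Dual F J) : auxact x ν = auxact y ν ↔ x - y ∈ auxS ν := by
  rw [aux_mem_S, LinearMap.ext_iff]
  refine forall_congr' fun z => ?_
  rw [auxact_apply, auxact_apply, ← sub_eq_zero, ← map_sub, add_sub_add_left_eq_sub, sub_mul]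

theorem auxact_mem {J : Type*} [NonUnitalRing J] [Module F J] [IsScalarTower F J J]
    [SMulCommClass F J J]
    (x g : J) (ν : Module.Dual F J) : g ∈ auxS (auxact x ν) ↔ g + x * g ∈ auxS ν := by
  rw [aux_mem_S, aux_mem_S]
  refine forall_congr' fun z => ?_
  rw [auxact_apply, add_mul, mul_assoc]

/-- Orbit relation under a subalgebra. -/
def auxSetoid' {J : Type*} [NonUnitalRing J] [Module F J] [SMulCommClass F J J]
    (inv : J → J) (hinv : ∀ x : J, qmul x (inv x) = 0 ∧ qmul (inv x) x = 0)
    (J' : NonUnitalSubalgebra F J) (hinv' : ∀ x ∈ J', inv x ∈ J') :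
    Setoid (Module.Dual F J) where
  r μ κ := ∃ h : J', auxact (h : J) μ = κ
  iseqv := by
    refine ⟨fun μ => ⟨0, auxact_zero μ⟩, ?_, ?_⟩
    · rintro μ κ ⟨y, rfl⟩
      refine ⟨⟨inv y, hinv' _ y.2⟩, ?_⟩
      rw [auxact_act, (hinv _).1, auxact_zero]
    · rintro μ κ ρ ⟨y, rfl⟩ ⟨z, rfl⟩
      refine ⟨⟨qmul y z, ?_⟩, ?_⟩
      · exact add_mem (add_mem y.2 z.2) (mul_mem y.2 z.2)
      · rw [auxact_act]

end Aux

/-- For a finite-dimensional nilpotent associative algebra `J` over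
`𝔽_q`, a nontrivial additive character `ε`, a subalgebra `J' ⊆ J`, and `λ ∈ J*`, the
restriction of the supercharacter `χ_λ` to `J'` is a linear combination of supercharacters
`χ'_μ`, `μ ∈ (J')*`, of `(J', ∘)` with nonnegative integer coefficients. -/
theorem restriction_of_supercharacter_algebra_group
    {F J : Type*} [Field F] [Fintype F] [DecidableEq F]
    [NonUnitalRing J] [Module F J] [IsScalarTower F J J] [SMulCommClass F J J]
    [Fintype J]
    (hnil : IsNilpotentAlgebra J)
    (ε : F → ℂ) (hε : ∀ a b : F, ε (a + b) = ε a * ε b) (hεnt : ∃ a : F, ε a ≠ 1)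
    (inv : J → J) (hinv : ∀ x : J, qmul x (inv x) = 0 ∧ qmul (inv x) x = 0)
    (J' : NonUnitalSubalgebra F J) [Fintype ↥J']
    (hinv' : ∀ x ∈ J', inv x ∈ J')
    (lam : Module.Dual F J) :
    ∃ n : Module.Dual F ↥J' →₀ ℕ,
      ∀ g : ↥J', superchar ε inv lam (g : J)
        = n.sum fun μ m => (m : ℂ) *
            superchar ε (fun x : ↥J' => (⟨inv (x : J), hinv' _ x.2⟩ : ↥J')) μ g := by
  classical
  let inv' : J' → J' := fun x => ⟨inv (x : J), hinv' _ x.2⟩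
  have hinv'' : ∀ x : J', qmul x (inv' x) = 0 ∧ qmul (inv' x) x = 0 := by
    intro x
    exact ⟨Subtype.ext (hinv x).1, Subtype.ext (hinv x).2⟩
  have key : (fun g : J' => superchar ε inv lam (g : J)) ∈
      AddSubmonoid.closure (Set.range fun κ : Module.Dual F J' => superchar ε inv' κ) := by
    let φ : Module.Dual F J → J' → ℂ := fun ν g => if (g : J) ∈ auxS ν then ε (ν g) else 0
    have hφ : ∀ x ν (g : J'), φ (auxact x ν) g =
        if (g : J) + x * g ∈ auxS ν then ε (ν (g + x * g)) else 0 := by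
      intro x ν g
      simp only [φ, auxact_mem, auxact_apply]
    have hcard : ∀ {K : Type _} [NonUnitalRing K] [Module F K] [Fintype K] (R : Submodule F K),
        ((Finset.univ.filter (fun x => x ∈ R)).card : ℂ) = (Nat.card R : ℂ) := by
      intro K _ _ _ R
      rw [Nat.card_eq_fintype_card, Fintype.card_subtype]
    have hne : ∀ {K : Type _} [NonUnitalRing K] [Module F K] [Fintype K] (R : Submodule F K),
        (Nat.card R : ℂ) ≠ 0 := by
      intro K _ _ _ R
      exact Nat.cast_ne_zero.2 Nat.card_pos.ne'
    have h1 : (fun g : J' => superchar ε inv lam (g : J)) =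
        ∑ ν ∈ Finset.univ.image (fun x => auxact x lam), φ ν := by
      funext g
      rw [aux_superchar_eq ε inv hinv, Finset.sum_apply]
      have := aux_count (fun x => auxact x lam) (Finset.univ.filter (fun x => x ∈ auxS lam))
        (by intro x y; rw [auxact_eq_iff]; simp) (fun ν => φ ν g)
      simp only [hφ] at this
      rw [this, hcard, one_div, inv_mul_cancel_left₀ (hne _)]
      refine Finset.sum_congr ?_ fun _ _ => rfl
      ext; simp
    rw [h1]
    refine aux_part_mem (auxSetoid' inv hinv J' hinv') _ _ _ ?_
    intro ν hν
    obtain ⟨x0, -, hx0⟩ := Finset.mem_image.1 hν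
    let sub : J' →ₗ[F] J := J'.toSubmodule.subtype
    have hsub : ∀ x, sub x = (x : J) := fun x => rfl
    let R : Submodule F J' := (auxS ν).comap sub
    have hRm : ∀ x : J', x ∈ R ↔ (x : J) ∈ auxS ν := fun x => Iff.rfl
    let μ : Module.Dual F J' := ν ∘ₗ sub
    convert aux_cone ε hε hεnt inv' hinv'' R μ ?_ ?_ using 1
    · funext g
      rw [Finset.sum_apply, Finset.sum_apply]
      refine Eq.trans ?_ ((aux_I_eq ε hε hεnt R μ g).trans ?_)
      swap
      · refine Finset.sum_congr ?_ fun _ _ => rfl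
        ext; simp
      have := aux_count (fun h : J' => auxact (h : J) ν) (Finset.univ.filter (fun x => x ∈ R))
        (by intro x y; rw [auxact_eq_iff]; simp [hRm]) (fun ν => φ ν g)
      have e : (∑ x : J', if g + x * g ∈ R then ε (μ (g + x * g)) else 0)
          = ∑ x : J', φ (auxact (x : J) ν) g := by
        refine Finset.sum_congr rfl fun x _ => ?_
        rw [hφ]
        rfl
      refine Eq.trans ?_ (congrArg _ (e.symm.trans ?_))
      rotate_left
      · refine Finset.sum_congr rfl fun _ _ => ?_
        congr
      rw [this, hcard, one_div, inv_mul_cancel_left₀ (hne _)]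
      refine Finset.sum_congr ?_ fun _ _ => rfl
      ext ρ
      simp only [Finset.mem_filter, Finset.mem_image, Finset.mem_univ, true_and]
      constructor
      · rintro ⟨-, h⟩; exact h
      · rintro ⟨h, rfl⟩
        refine ⟨⟨qmul x0 h, ?_⟩, ⟨h, rfl⟩⟩
        rw [← hx0, auxact_act]
    · intro x hx y z
      change ν ((x : J) * y * z) = 0
      rw [mul_assoc]; exact hx _
    · intro x hx y
      exact hx _
  obtain ⟨n, hn⟩ := AddSubmonoid.mem_closure_range_iff.1 key
  refine ⟨n, fun g => ?_⟩
  have := congrFun hn g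
  refine Eq.trans this ?_
  simp only [Finsupp.sum, Finset.sum_apply, Pi.smul_apply, nsmul_eq_mul]
  rfl
end

section
/- Let V be a finite-dimensional vector space over a finite field 𝔽_q, let G be a finite group, and let ρ : G → GL(V) be a group homomorphism (a linear action of G on V). Let G act on the dual space V* by (g·λ)(v) = λ(ρ(g)⁻¹ v). Then the number of G-orbits on V equals the number of G-orbits on V*. -/
/-- Let `V` be a finite-dimensional vector space over a finite field, let
a finite group `G` act linearly on `V`, and let `G` act on the dual space `V*` by the
contragredient action `(g • λ)(v) = λ(g⁻¹ • v)`.  Then the number of `G`-orbits on `V`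
equals the number of `G`-orbits on `V*`. -/
theorem card_orbits_eq_card_orbits_dual
    {F V G : Type*} [Field F] [Fintype F]
    [AddCommGroup V] [Module F V] [FiniteDimensional F V]
    [Group G] [Finite G]
    [MulAction G V] (hlin : ∀ g : G, IsLinearMap F (fun v : V => g • v))
    [MulAction G (Module.Dual F V)]
    (hdual : ∀ (g : G) (lam : Module.Dual F V) (v : V), (g • lam) v = lam (g⁻¹ • v)) :
    Nat.card (Quotient (MulAction.orbitRel G V))
      = Nat.card (Quotient (MulAction.orbitRel G (Module.Dual F V))) := by
  classical
  have hfix : ∀ g : G, Nat.card (MulAction.fixedBy V g)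
      = Nat.card (MulAction.fixedBy (Module.Dual F V) g) := by
    intro g
    let T : V →ₗ[F] V := (hlin g).mk' _ - LinearMap.id
    have hT : ∀ v, T v = g • v - v := fun v => rfl
    have h1 : MulAction.fixedBy V g = (LinearMap.ker T : Set V) := by
      ext v
      simp [hT, sub_eq_zero]
    have h2 : MulAction.fixedBy (Module.Dual F V) g
        = (LinearMap.ker T.dualMap : Set (Module.Dual F V)) := by
      ext l
      simp only [MulAction.mem_fixedBy, SetLike.mem_coe, LinearMap.mem_ker]
      constructor
      · intro h
        ext v
        have := hdual g l (g • v)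
        rw [h, inv_smul_smul] at this
        simp [LinearMap.dualMap_apply, hT, this]
      · intro h
        ext v
        have := LinearMap.congr_fun h (g⁻¹ • v)
        rw [LinearMap.dualMap_apply, hT, smul_inv_smul, map_sub] at this
        rw [hdual]
        exact (sub_eq_zero.mp this).symm
    rw [h1, h2]
    change Nat.card (LinearMap.ker T) = Nat.card (LinearMap.ker T.dualMap)
    rw [Module.natCard_eq_pow_finrank (K := F) (V := LinearMap.ker T),
      Module.natCard_eq_pow_finrank (K := F) (V := LinearMap.ker T.dualMap)]
    have e1 := LinearMap.finrank_range_add_finrank_ker T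
    have e2 := LinearMap.finrank_range_add_finrank_ker T.dualMap
    have e3 := LinearMap.finrank_range_dualMap_eq_finrank_range T
    have e4 := Subspace.dual_finrank_eq (K := F) (V := V)
    congr 1
    omega
  have : Finite V := Module.finite_of_finite F
  have : Finite (Module.Dual F V) := Module.finite_of_finite F
  have := Fintype.ofFinite G
  have := Fintype.ofFinite V
  have := Fintype.ofFinite (Module.Dual F V)
  have := Fintype.ofFinite (Quotient (MulAction.orbitRel G V))
  have := Fintype.ofFinite (Quotient (MulAction.orbitRel G (Module.Dual F V)))
  have b1 := MulAction.sum_card_fixedBy_eq_card_orbits_mul_card_group G V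
  have b2 := MulAction.sum_card_fixedBy_eq_card_orbits_mul_card_group G (Module.Dual F V)
  simp only [← Nat.card_eq_fintype_card] at b1 b2
  simp only [hfix] at b1
  exact Nat.eq_of_mul_eq_mul_right Nat.card_pos (b1.symm.trans b2)
end
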